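/- arXiv:2602.07562 — 2 statements merged into one kernel-verified Lean document; each statement's English description precedes it below -/
import Mathlib

section
/- Almost-sure linear independence of Gaussian match-and-copy difference features: let the tokens e⁽ⁱ⁾_t (1 ≤ i ≤ n, 1 ≤ t ≤ T) be i.i.d. N(0, (σ²/d) I_d) Gaussian vectors, set q⁽ⁱ⁾ := e⁽ⁱ⁾_{y_i}, and x̃_{i,t} := flatten((e⁽ⁱ⁾_{t+1} − e⁽ⁱ⁾_{y_i+1}) q⁽ⁱ⁾ᵀ) ∈ ℝ^{d²} for t ∈ {1,…,T−1} \ {y_i}. Then for every fixed index set I ⊆ {(i,t) : 1 ≤ i ≤ n, t ∈ {1,…,T−1} \ {y_i}} such that the number of distinct sample indices i appearing in I is at most d and, for each i, the number of positions t with (i,t) ∈ I is at most d, the family {x̃_{i,t}}_{(i,t)∈I} is almost surely linearly independent. In particular, if d ≥ max(n_SV, T_SV), where n_SV is the number of samples containing support vectors of the max-margin problem and T_SV is the maximum number of support vectors in a single sample, then the support vectors are almost surely linearly independent. -/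
open scoped BigOperators NNReal Classical
open Finset MeasureTheory ProbabilityTheory

noncomputable section

/-- Token at (1-based) position `t ∈ {1,…,T}` of sample `i`, read off from the sample
point `ω` of the product Gaussian space (junk value `0` outside `{1,…,T}`). -/
def tok (d T n : ℕ) (ω : Fin n × Fin T → Fin d → ℝ) (i : Fin n) (t : ℕ) : Fin d → ℝ :=
  if h : 1 ≤ t ∧ t ≤ T then ω (i, ⟨t - 1, by omega⟩) else 0

/-- Difference features `x̃_{i,t} := flatten((e⁽ⁱ⁾_{t+1} − e⁽ⁱ⁾_{y_i+1}) q⁽ⁱ⁾ᵀ) ∈ ℝ^{d²}`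
with exact-match query `q⁽ⁱ⁾ = e⁽ⁱ⁾_{y_i}`. -/
def xtil (d T n : ℕ) (ω : Fin n × Fin T → Fin d → ℝ) (y : Fin n → ℕ)
    (i : Fin n) (t : ℕ) : Fin d × Fin d → ℝ :=
  fun p => (tok d T n ω i (t + 1) p.1 - tok d T n ω i (y i + 1) p.1) *
    tok d T n ω i (y i) p.2

/-- The i.i.d. `N(0, (σ²/d) I_d)` product measure over all tokens of all samples. -/
def gmcMeasure (d T n : ℕ) (σ : ℝ≥0) : Measure (Fin n × Fin T → Fin d → ℝ) :=
  Measure.pi fun _ : Fin n × Fin T =>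
    Measure.pi fun _ : Fin d => gaussianReal 0 (σ ^ 2 / (d : ℝ≥0))

/-- A measurable set all of whose slices in one fixed coordinate are null is null. -/
theorem pi_eq_zero_of_slices {ι : Type*} [Fintype ι] [DecidableEq ι] {α : ι → Type*}
    [∀ i, MeasurableSpace (α i)] (μ : ∀ i, Measure (α i)) [∀ i, SigmaFinite (μ i)] (i : ι)
    {s : Set (∀ i, α i)} (hs : MeasurableSet s)
    (h : ∀ x, μ i {a | Function.update x i a ∈ s} = 0) : Measure.pi μ s = 0 := by
  have hm : Measurable (s.indicator (1 : (∀ i, α i) → ENNReal)) := measurable_one.indicator hs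
  rcases isEmpty_or_nonempty (∀ i, α i) with hα | ⟨⟨x⟩⟩
  · simp [Set.eq_empty_of_isEmpty s]
  rw [← lintegral_indicator_one hs, lintegral_eq_lmarginal_univ x,
    lmarginal_erase' _ hm (Finset.mem_univ i)]
  have h0 : (fun x => ∫⁻ a, s.indicator (1 : (∀ i, α i) → ENNReal) (Function.update x i a) ∂μ i)
      = 0 := by
    funext x
    have hp : MeasurableSet {a | Function.update x i a ∈ s} := measurable_update x hs
    rw [Pi.zero_apply, ← h x, ← lintegral_indicator_one hp]
    rfl
  rw [h0]
  simp [lmarginal]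

/-- A product of atomless measures on `ℝ` vanishes on every proper affine subspace. -/
theorem pi_translate_submodule_eq_zero {κ : Type*} [Fintype κ] (μ : κ → Measure ℝ)
    [∀ j, SigmaFinite (μ j)] [∀ j, NullSingletonClass (μ j)] (W : Submodule ℝ (κ → ℝ)) (hW : W ≠ ⊤)
    (a : κ → ℝ) : Measure.pi μ {x | x - a ∈ W} = 0 := by
  obtain ⟨f, hf, hWf⟩ := W.exists_le_ker_of_lt_top hW.lt_top
  obtain ⟨j, hj⟩ : ∃ j, f (Pi.single j 1) ≠ 0 := by
    by_contra! hc
    exact hf (LinearMap.pi_ext' fun j => LinearMap.ext_ring (by simpa using hc j))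
  refine measure_mono_null (t := {x | f (x - a) = 0}) (fun x hx => hWf hx) ?_
  have hfc : Continuous f := f.continuous_of_finiteDimensional
  refine pi_eq_zero_of_slices μ j
    (isClosed_eq (hfc.comp (continuous_id.sub continuous_const)) continuous_const).measurableSet
    fun x => ?_
  refine Set.Subsingleton.measure_zero (fun r hr r' hr' => ?_) _
  have hu : Function.update x j r - a - (Function.update x j r' - a)
      = (r - r') • Pi.single (M := fun _ => ℝ) j 1 := by
    ext k
    by_cases hk : k = j
    · subst hk; simp
    · simp [hk]
  have : f (Function.update x j r - a - (Function.update x j r' - a)) = 0 := by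
    rw [map_sub, show f (Function.update x j r - a) = 0 from hr,
      show f (Function.update x j r' - a) = 0 from hr', sub_zero]
  rw [hu, map_smul, smul_eq_mul] at this
  exact sub_eq_zero.1 ((mul_eq_zero.1 this).resolve_right hj)

/-- At most `dim E` independent random vectors whose common law vanishes on proper affine
subspaces, all shifted by a vector depending only on the remaining coordinates, are almost surely
linearly independent. -/
theorem ae_linearIndepOn_sub {ι E : Type*} [Fintype ι] [DecidableEq ι] [NormedAddCommGroup E]
    [NormedSpace ℝ E] [FiniteDimensional ℝ E] [SecondCountableTopology E] [MeasurableSpace E]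
    [BorelSpace E] (ν : Measure E) [SigmaFinite ν]
    (hν : ∀ W : Submodule ℝ E, W ≠ ⊤ → ∀ a, ν {x | x - a ∈ W} = 0)
    {a : (ι → E) → E} (ha : Continuous a) (S : Finset ι)
    (haS : ∀ ω, ∀ k ∈ S, ∀ x, a (Function.update ω k x) = a ω)
    (hS : S.card ≤ Module.finrank ℝ E) :
    ∀ᵐ ω ∂Measure.pi (fun _ : ι => ν), LinearIndepOn ℝ (fun k => ω k - a ω) (S : Set ι) := by
  have hmeas (S : Finset ι) :
      MeasurableSet {ω : ι → E | LinearIndepOn ℝ (fun k => ω k - a ω) (S : Set ι)} := by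
    have hc : Continuous fun (ω : ι → E) (k : (S : Set ι)) => ω k - a ω := by fun_prop
    exact (isOpen_setOfPred_linearIndependent.preimage hc).measurableSet
  induction S using Finset.induction_on with
  | empty => simp
  | insert k S hk ih =>
    rw [Finset.card_insert_of_notMem hk] at hS
    have ih := ih (fun ω j hj => haS ω j (Finset.mem_insert_of_mem hj)) (by omega)
    have hbad : Measure.pi (fun _ : ι => ν)
        ({ω | LinearIndepOn ℝ (fun k => ω k - a ω) (S : Set ι)} \
          {ω | LinearIndepOn ℝ (fun k => ω k - a ω) ((insert k S : Finset ι) : Set ι)}) = 0 := by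
      refine pi_eq_zero_of_slices _ k ((hmeas S).diff (hmeas _)) fun ω => ?_
      set W := Submodule.span ℝ ((fun k => ω k - a ω) '' (S : Set ι)) with hWdef
      have hW : W ≠ ⊤ := by
        intro hW
        have h1 : Module.finrank ℝ W ≤ S.card := by
          rw [hWdef, ← Finset.coe_image]
          exact (finrank_span_finset_le_card _).trans Finset.card_image_le
        rw [hW, finrank_top] at h1
        omega
      refine measure_mono_null (fun x hx => ?_) (hν W hW (a ω))
      obtain ⟨hx, hx'⟩ := hx
      have hax := haS ω k (Finset.mem_insert_self k S) x
      have heq : Set.EqOn (fun j => Function.update ω k x j - a (Function.update ω k x))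
          (fun j => ω j - a ω) (S : Set ι) := fun j hj => by
        have : j ≠ k := fun h => hk (h ▸ hj)
        simp [this, hax]
      by_contra hxW
      refine hx' ?_
      simp only [Set.mem_ofPred_eq, Finset.coe_insert] at hx ⊢
      rw [linearIndepOn_insert (by simpa using hk)]
      refine ⟨hx, ?_⟩
      rw [heq.image_eq]
      simpa [hax] using hxW
    filter_upwards [ih, measure_eq_zero_iff_ae_notMem.1 hbad] with ω h1 h2
    by_contra h3
    exact h2 ⟨h1, h3⟩

/-- Outer products `u p ⊗ q p.1` are linearly independent when the `q i` are and, for each `i`,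
the `u p` with `p.1 = i` are. -/
theorem linearIndepOn_outer {α β κ ι : Type*} [DecidableEq α] (I : Finset (α × β))
    {u : α × β → κ → ℝ} {q : α → ι → ℝ}
    (hq : LinearIndepOn ℝ q (I.image Prod.fst : Finset α))
    (hu : ∀ i, LinearIndepOn ℝ u (I.filter (fun p => p.1 = i) : Finset (α × β))) :
    LinearIndepOn ℝ (fun p (ab : κ × ι) => u p ab.1 * q p.1 ab.2) (I : Set (α × β)) := by
  rw [linearIndepOn_finset_iff] at hq ⊢
  intro c hc p hp
  refine linearIndepOn_finset_iff.1 (hu p.1) c ?_ p (by simp [hp])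
  ext a
  have hrow := hq (fun i => ∑ p ∈ I.filter (fun p => p.1 = i), c p * u p a) ?_ p.1
    (Finset.mem_image_of_mem _ hp)
  · simpa [Finset.sum_apply] using hrow
  ext b
  have hab := congrFun hc (a, b)
  rw [← Finset.sum_fiberwise_of_maps_to (t := I.image Prod.fst) (g := Prod.fst)
    (fun p hp => Finset.mem_image_of_mem _ hp)] at hab
  simp only [Finset.sum_apply, Pi.smul_apply, smul_eq_mul, Pi.zero_apply] at hab ⊢
  rw [← hab]
  refine Finset.sum_congr rfl fun i _ => ?_
  rw [Finset.sum_mul]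
  refine Finset.sum_congr rfl fun p hp => ?_
  rw [(Finset.mem_filter.1 hp).2, mul_assoc]

theorem tok_succ {d T n : ℕ} (ω : Fin n × Fin T → Fin d → ℝ) (i : Fin n) {t : ℕ} (ht : t < T) :
    tok d T n ω i (t + 1) = ω (i, ⟨t, ht⟩) :=
  dif_pos ⟨by omega, ht⟩

/-- The Gaussian law of a single token vanishes on every proper affine subspace. -/
theorem gaussian_translate_submodule_eq_zero {d : ℕ} (hd : 1 ≤ d) {σ : ℝ≥0} (hσ : 0 < σ)
    (W : Submodule ℝ (Fin d → ℝ)) (hW : W ≠ ⊤) (a : Fin d → ℝ) :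
    Measure.pi (fun _ : Fin d => gaussianReal 0 (σ ^ 2 / (d : ℝ≥0))) {x | x - a ∈ W} = 0 := by
  have hvar : σ ^ 2 / (d : ℝ≥0) ≠ 0 :=
    div_ne_zero (pow_ne_zero 2 hσ.ne') (Nat.cast_ne_zero.2 (by omega))
  have := nullSingletonClass_gaussianReal (μ := 0) hvar
  exact pi_translate_submodule_eq_zero _ W hW a

/-- At most `d` queries from distinct samples are almost surely linearly independent. -/
theorem ae_linearIndepOn_query {d T n : ℕ} (hd : 1 ≤ d) {σ : ℝ≥0} (hσ : 0 < σ)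
    {y : Fin n → ℕ} (hy : ∀ i, 1 ≤ y i ∧ y i < T) (J : Finset (Fin n)) (hJ : J.card ≤ d) :
    ∀ᵐ ω ∂(gmcMeasure d T n σ),
      LinearIndepOn ℝ (fun i => tok d T n ω i (y i)) (J : Set (Fin n)) := by
  let f (i : Fin n) : Fin n × Fin T := (i, ⟨y i - 1, by have := hy i; omega⟩)
  have h := ae_linearIndepOn_sub _ (gaussian_translate_submodule_eq_zero hd hσ)
    (ι := Fin n × Fin T) (a := fun _ => 0) continuous_const
    (J.image f) (fun _ _ _ _ => rfl) (Finset.card_image_le.trans (by simpa using hJ))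
  filter_upwards [h] with ω hω
  rw [Finset.coe_image] at hω
  refine (hω.comp_of_image fun i _ j _ hij => congrArg Prod.fst hij).congr fun i _ => ?_
  have hi := hy i
  simp only [Function.comp_apply, sub_zero, f]
  rw [tok, dif_pos ⟨hi.1, hi.2.le⟩]

/-- At most `d` difference vectors from one sample are almost surely linearly independent. -/
theorem ae_linearIndepOn_difference {d T n : ℕ} (hd : 1 ≤ d) {σ : ℝ≥0} (hσ : 0 < σ) (i : Fin n)
    {s : ℕ} (hs : s < T) (J : Finset ℕ) (hJ : ∀ t ∈ J, t < T ∧ t ≠ s) (hcard : J.card ≤ d) :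
    ∀ᵐ ω ∂(gmcMeasure d T n σ), LinearIndepOn ℝ
      (fun t => tok d T n ω i (t + 1) - tok d T n ω i (s + 1)) (J : Set ℕ) := by
  let f (t : ℕ) : Fin n × Fin T := (i, ⟨t % T, Nat.mod_lt t (by omega)⟩)
  have hf {t : ℕ} (ht : t < T) : f t = (i, ⟨t, ht⟩) := by simp [f, Nat.mod_eq_of_lt ht]
  have h := ae_linearIndepOn_sub _ (gaussian_translate_submodule_eq_zero hd hσ)
    (a := fun ω => ω (i, ⟨s, hs⟩)) (continuous_apply _) (J.image f) ?_
    (Finset.card_image_le.trans (by simpa using hcard))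
  · filter_upwards [h] with ω hω
    rw [Finset.coe_image] at hω
    refine (hω.comp_of_image fun t ht r hr htr => ?_).congr fun t ht => ?_
    · simpa [hf (hJ t ht).1, hf (hJ r hr).1] using htr
    · simp only [Function.comp_apply, hf (hJ t ht).1, tok_succ ω i (hJ t ht).1, tok_succ ω i hs]
  · intro ω k hk x
    obtain ⟨t, ht, rfl⟩ := Finset.mem_image.1 hk
    refine Function.update_of_ne (fun hne => (hJ t ht).2 ?_) _ _
    rw [hf (hJ t ht).1] at hne
    simpa using hne.symm

theorem xtil_eq_outer (d T n : ℕ) (ω : Fin n × Fin T → Fin d → ℝ) (y : Fin n → ℕ)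
    (p : Fin n × ℕ) :
    xtil d T n ω y p.1 p.2 = fun ab : Fin d × Fin d =>
      (tok d T n ω p.1 (p.2 + 1) - tok d T n ω p.1 (y p.1 + 1)) ab.1 *
        tok d T n ω p.1 (y p.1) ab.2 :=
  rfl

/-- The difference features inherit linear independence from the queries and, sample by sample,
from the difference vectors. -/
theorem linearIndepOn_xtil {d T n : ℕ} {ω : Fin n × Fin T → Fin d → ℝ} {y : Fin n → ℕ}
    {I : Finset (Fin n × ℕ)}
    (hq : LinearIndepOn ℝ (fun i => tok d T n ω i (y i)) (I.image Prod.fst : Finset (Fin n)))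
    (hu : ∀ i, LinearIndepOn ℝ
      (fun p : Fin n × ℕ => tok d T n ω p.1 (p.2 + 1) - tok d T n ω p.1 (y p.1 + 1))
      (I.filter (fun p => p.1 = i) : Finset (Fin n × ℕ))) :
    LinearIndepOn ℝ (fun p => xtil d T n ω y p.1 p.2) (I : Set (Fin n × ℕ)) := by
  simp only [xtil_eq_outer]
  exact linearIndepOn_outer I hq hu

/-- Almost-sure linear independence of Gaussian match-and-copy
difference features: for any fixed index set `I` of pairs `(i,t)` with `t ∈ {1,…,T−1}`,
`t ≠ y_i`, such that at most `d` distinct samples appear and each sample contributes at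
most `d` positions, the family `{x̃_{i,t}}_{(i,t)∈I}` is almost surely linearly
independent. -/
theorem stmt_7 (d T n : ℕ) (hd : 1 ≤ d) (hT : 3 ≤ T) (hn : 1 ≤ n)
    (σ : ℝ≥0) (hσ : 0 < σ)
    (y : Fin n → ℕ) (hy : ∀ i, y i ∈ Finset.Icc 1 (T - 1))
    (I : Finset (Fin n × ℕ))
    (hImem : ∀ p ∈ I, p.2 ∈ Finset.Icc 1 (T - 1) ∧ p.2 ≠ y p.1)
    (hrows : (I.image Prod.fst).card ≤ d)
    (hcols : ∀ i : Fin n, (I.filter (fun p => p.1 = i)).card ≤ d) :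
    ∀ᵐ ω ∂(gmcMeasure d T n σ),
      LinearIndependent ℝ (fun p : ↥I => xtil d T n ω y p.1.1 p.1.2) := by
  have hyT (i : Fin n) : 1 ≤ y i ∧ y i < T := by
    have := Finset.mem_Icc.1 (hy i)
    omega
  have hinj (i : Fin n) :
      Set.InjOn Prod.snd (I.filter (fun p => p.1 = i) : Set (Fin n × ℕ)) := by
    intro p hp r hr hpr
    exact Prod.ext ((Finset.mem_filter.1 hp).2.trans (Finset.mem_filter.1 hr).2.symm) hpr
  have hdiff : ∀ᵐ ω ∂(gmcMeasure d T n σ), ∀ i, LinearIndepOn ℝ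
      (fun t => tok d T n ω i (t + 1) - tok d T n ω i (y i + 1))
      ((I.filter (fun p => p.1 = i)).image Prod.snd : Finset ℕ) := by
    refine ae_all_iff.2 fun i => ae_linearIndepOn_difference hd hσ i (hyT i).2 _ (fun t ht => ?_)
      (Finset.card_image_le.trans (hcols i))
    obtain ⟨p, hp, rfl⟩ := Finset.mem_image.1 ht
    obtain ⟨hpI, rfl⟩ := Finset.mem_filter.1 hp
    obtain ⟨hpT, hne⟩ := hImem p hpI
    have := Finset.mem_Icc.1 hpT
    exact ⟨by omega, hne⟩
  filter_upwards [ae_linearIndepOn_query hd hσ hyT _ hrows, hdiff] with ω hq hu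
  refine linearIndepOn_xtil hq fun i => ?_
  have hui := hu i
  rw [Finset.coe_image] at hui
  refine (hui.comp_of_image (hinj i)).congr fun p hp => ?_
  rw [← (Finset.mem_filter.1 hp).2, Function.comp_apply]
end
end

section
/- Existence and uniqueness of the correction vector: let {x̃_j}_{j∈J} be a finite linearly independent family in ℝ^D, partitioned into groups J = ⊔_i J_i, and let η > 0 and h_j > 0, α_j > 0 for all j ∈ J. Then there exists a unique w̃ in span{x̃_j : j ∈ J} such that η h_j e^{−w̃ᵀ x̃_j} Σ_{s ∈ J_{i(j)}} e^{−w̃ᵀ x̃_s} = α_j/2 for every j ∈ J, where i(j) denotes the group containing j. Explicitly, setting c_j := α_j/(2 η h_j) and z_j := c_j / sqrt(Σ_{s∈J_{i(j)}} c_s), w̃ is the unique element of the span satisfying w̃ᵀ x̃_j = −log(z_j) for all j ∈ J. -/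
open scoped RealInnerProductSpace BigOperators Classical
open Finset

noncomputable section

/-- A linearly independent finite family can be given arbitrary inner products by an element of
its span. -/
theorem LinearIndependent.exists_mem_span_inner_eq {ι E : Type*} [Finite ι]
    [NormedAddCommGroup E] [InnerProductSpace ℝ E] {v : ι → E}
    (hv : LinearIndependent ℝ v) (β : ι → ℝ) :
    ∃ w ∈ Submodule.span ℝ (Set.range v), ∀ j, ⟪w, v j⟫ = β j := by
  have : FiniteDimensional ℝ (Submodule.span ℝ (Set.range v)) :=
    FiniteDimensional.span_of_finite ℝ (Set.finite_range v)
  let b := Module.Basis.span hv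
  let f := LinearMap.toContinuousLinearMap (b.constr ℝ β)
  let w := (InnerProductSpace.toDual ℝ (Submodule.span ℝ (Set.range v))).symm f
  refine ⟨w, w.2, fun j => ?_⟩
  have hj : ⟪w, b j⟫ = β j := by
    rw [InnerProductSpace.toDual_symm_apply]
    exact b.constr_basis ℝ β j
  rwa [Submodule.coe_inner, Module.Basis.span_apply] at hj

/-- An element of a span is determined by its inner products with the spanning set. -/
theorem Submodule.eq_of_mem_span_of_inner_eq {E : Type*} [NormedAddCommGroup E]
    [InnerProductSpace ℝ E] {s : Set E} {w w' : E} (hw : w ∈ Submodule.span ℝ s)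
    (hw' : w' ∈ Submodule.span ℝ s) (h : ∀ x ∈ s, ⟪w, x⟫ = ⟪w', x⟫) : w = w' := by
  have horth : ∀ x ∈ Submodule.span ℝ s, ⟪w - w', x⟫ = 0 := fun x hx => by
    induction hx using Submodule.span_induction with
    | mem x hx => rw [inner_sub_left, h x hx, sub_self]
    | zero => exact inner_zero_right _
    | add x y _ _ hx hy => rw [inner_add_right, hx, hy, add_zero]
    | smul a x _ hx => rw [real_inner_smul_right, hx, mul_zero]
  exact sub_eq_zero.1 (inner_self_eq_zero.1 (horth _ (Submodule.sub_mem _ hw hw')))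

/-- The positive solution of the groupwise quadratic system `e_j * ∑_{s ∼ j} e_s = c_j`. -/
theorem forall_mul_sum_fiber_eq_iff {ι κ : Type*} {J : Finset ι} (grp : ι → κ) {e c : ι → ℝ}
    (he : ∀ j ∈ J, 0 < e j) (hc : ∀ j ∈ J, 0 < c j) :
    (∀ j ∈ J, e j * ∑ s ∈ J.filter (fun s => grp s = grp j), e s = c j) ↔
      ∀ j ∈ J, e j = c j / Real.sqrt (∑ s ∈ J.filter (fun s => grp s = grp j), c s) := by
  have hpos : ∀ {a : ι → ℝ}, (∀ j ∈ J, 0 < a j) → ∀ j ∈ J,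
      0 < ∑ s ∈ J.filter (fun s => grp s = grp j), a s := fun ha j hj =>
    Finset.sum_pos (fun s hs => ha s (Finset.mem_filter.1 hs).1)
      ⟨j, Finset.mem_filter.2 ⟨hj, rfl⟩⟩
  constructor
  · intro H j hj
    have hS := hpos he j hj
    have hsum : ∑ s ∈ J.filter (fun s => grp s = grp j), c s =
        (∑ s ∈ J.filter (fun s => grp s = grp j), e s) ^ 2 := by
      rw [sq, Finset.sum_mul]
      refine Finset.sum_congr rfl fun s hs => ?_
      obtain ⟨hsJ, hsj⟩ := Finset.mem_filter.1 hs
      rw [← H s hsJ, hsj]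
    rw [hsum, Real.sqrt_sq hS.le, eq_div_iff hS.ne', H j hj]
  · intro H j hj
    have hC := hpos hc j hj
    have hsum : ∑ s ∈ J.filter (fun s => grp s = grp j), e s =
        Real.sqrt (∑ s ∈ J.filter (fun s => grp s = grp j), c s) := by
      rw [← Real.div_sqrt, Finset.sum_div]
      refine Finset.sum_congr rfl fun s hs => ?_
      obtain ⟨hsJ, hsj⟩ := Finset.mem_filter.1 hs
      rw [H s hsJ, hsj]
    rw [hsum, H j hj, div_mul_cancel₀ _ (Real.sqrt_pos.2 hC).ne']

/-- Existence and uniqueness of the correction vector: for a finite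
linearly independent family `{x̃_j}_{j∈J}` in `ℝ^D` partitioned into groups (fibers of
`grp`), and constants `η > 0`, `h_j > 0`, `α_j > 0`, there is a unique `w̃` in
`span{x̃_j : j ∈ J}` with `η h_j e^{−w̃ᵀx̃_j} Σ_{s∈J_{i(j)}} e^{−w̃ᵀx̃_s} = α_j/2` for all
`j ∈ J`; explicitly, it is the unique element of the span with
`w̃ᵀ x̃_j = −log(z_j)`, `z_j = c_j/√(Σ_{s∈J_{i(j)}} c_s)`, `c_j = α_j/(2η h_j)`. -/
theorem stmt_16 {ι κ : Type*} (D : ℕ) (J : Finset ι)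
    (xt : ι → EuclideanSpace ℝ (Fin D))
    (hli : LinearIndependent ℝ (fun j : ↥J => xt j))
    (grp : ι → κ) (η : ℝ) (hη : 0 < η) (h α : ι → ℝ)
    (hh : ∀ j ∈ J, 0 < h j) (hα : ∀ j ∈ J, 0 < α j) :
    (∃! w : EuclideanSpace ℝ (Fin D),
      w ∈ Submodule.span ℝ (xt '' (J : Set ι)) ∧
      ∀ j ∈ J, η * h j * Real.exp (-⟪w, xt j⟫) *
          (∑ s ∈ J.filter (fun s => grp s = grp j), Real.exp (-⟪w, xt s⟫)) = α j / 2)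
    ∧ ∀ w : EuclideanSpace ℝ (Fin D),
        (w ∈ Submodule.span ℝ (xt '' (J : Set ι)) ∧
          ∀ j ∈ J, η * h j * Real.exp (-⟪w, xt j⟫) *
            (∑ s ∈ J.filter (fun s => grp s = grp j), Real.exp (-⟪w, xt s⟫)) = α j / 2) →
        ∀ j ∈ J, ⟪w, xt j⟫
          = - Real.log ((α j / (2 * η * h j)) /
              Real.sqrt (∑ s ∈ J.filter (fun s => grp s = grp j), α s / (2 * η * h s))) := by
  have hc : ∀ j ∈ J, 0 < α j / (2 * η * h j) := fun j hj => by
    have := hh j hj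
    have := hα j hj
    positivity
  have key : ∀ w : EuclideanSpace ℝ (Fin D),
      (∀ j ∈ J, η * h j * Real.exp (-⟪w, xt j⟫) *
        (∑ s ∈ J.filter (fun s => grp s = grp j), Real.exp (-⟪w, xt s⟫)) = α j / 2) ↔
      ∀ j ∈ J, ⟪w, xt j⟫ = - Real.log ((α j / (2 * η * h j)) /
        Real.sqrt (∑ s ∈ J.filter (fun s => grp s = grp j), α s / (2 * η * h s))) := by
    intro w
    have hsys := forall_mul_sum_fiber_eq_iff (J := J) grp
      (e := fun j => Real.exp (-⟪w, xt j⟫)) (fun j _ => Real.exp_pos _) hc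
    refine Iff.trans (forall₂_congr fun j hj => ?_) (hsys.trans (forall₂_congr fun j hj => ?_))
    · have := hh j hj
      rw [eq_div_iff (by positivity), eq_div_iff (by positivity)]
      constructor <;> intro H <;> linarith
    · have hz : 0 < (α j / (2 * η * h j)) /
          Real.sqrt (∑ s ∈ J.filter (fun s => grp s = grp j), α s / (2 * η * h s)) :=
        div_pos (hc j hj) (Real.sqrt_pos.2 (Finset.sum_pos
          (fun s hs => hc s (Finset.mem_filter.1 hs).1) ⟨j, Finset.mem_filter.2 ⟨hj, rfl⟩⟩))
      rw [← Real.exp_eq_exp.trans neg_eq_iff_eq_neg, Real.exp_log hz]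
  refine ⟨?_, fun w hw => (key w).1 hw.2⟩
  obtain ⟨w, hw, hwβ⟩ := hli.exists_mem_span_inner_eq fun j =>
    - Real.log ((α j / (2 * η * h j)) /
      Real.sqrt (∑ s ∈ J.filter (fun s => grp s = grp j), α s / (2 * η * h s)))
  have hrange : Set.range (fun j : ↥J => xt j) = xt '' (J : Set ι) :=
    (Set.image_eq_range xt (J : Set ι)).symm
  rw [hrange] at hw
  have hwJ := fun j hj => hwβ ⟨j, hj⟩
  refine ⟨w, ⟨hw, (key w).2 hwJ⟩, fun w' hw' => ?_⟩
  refine Submodule.eq_of_mem_span_of_inner_eq hw'.1 hw ?_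
  rintro _ ⟨j, hj, rfl⟩
  exact ((key w').1 hw'.2 j hj).trans (hwJ j hj).symm
end
end
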